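/- Let H = ⟨x, y, z | [x,y] = z, [x,z] = [y,z] = 1⟩ be the discrete Heisenberg group and let M be an abelian group regarded as a trivial H-module. Then H²(H, M) ≅ M² and H³(H, M) ≅ M. -/

import Mathlib

/-- Relations of the discrete Heisenberg group `⟨x, y, z | [x,y] = z, [x,z] = [y,z] = 1⟩`
on generators `x = of 0`, `y = of 1`, `z = of 2`. -/
def heisenbergRels : Set (FreeGroup (Fin 3)) :=
  { FreeGroup.of 0 * FreeGroup.of 1 * (FreeGroup.of 0)⁻¹ * (FreeGroup.of 1)⁻¹ *
      (FreeGroup.of 2)⁻¹,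
    FreeGroup.of 0 * FreeGroup.of 2 * (FreeGroup.of 0)⁻¹ * (FreeGroup.of 2)⁻¹,
    FreeGroup.of 1 * FreeGroup.of 2 * (FreeGroup.of 1)⁻¹ * (FreeGroup.of 2)⁻¹ }

/-- The discrete Heisenberg group. -/
abbrev HeisenbergGroup : Type := PresentedGroup heisenbergRels

namespace HeisH3
open CategoryTheory Rep

variable {G : Type} [Group G] {M : Type} [AddCommGroup M]

/-- a right action of G on X -/
structure RAct (G : Type) [Group G] (X : Type) where
  r : X → G → X
  one : ∀ p, r p 1 = p
  mul : ∀ p g h, r p (g * h) = r (r p g) h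

/-- functions on a right G-set -/
def funRho (M : Type) [AddCommGroup M] {X : Type} (A : RAct G X) :
    Representation ℤ G (X → M) where
  toFun g := LinearMap.funLeft ℤ M (fun p => A.r p g)
  map_one' := by ext f p; simp [LinearMap.funLeft_apply, A.one]
  map_mul' g h := by ext f p; simp [LinearMap.funLeft_apply, A.mul]

abbrev fr (M : Type) [AddCommGroup M] {X : Type} (A : RAct G X) : Rep.{0} ℤ G := Rep.of (funRho M A)

lemma funRho_apply {X : Type} (A : RAct G X) (g : G) (f : X → M) (p : X) :
    funRho M A g f p = f (A.r p g) := rfl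

def pb (M : Type) [AddCommGroup M] {X Y : Type} (A : RAct G X) (B : RAct G Y) (s : X → Y)
    (hs : ∀ p g, s (A.r p g) = B.r (s p) g) : fr M B ⟶ fr M A :=
  Rep.ofHom ⟨LinearMap.funLeft ℤ M s, by
    intro g; ext f p
    simp [LinearMap.funLeft_apply, funRho_apply, hs]⟩

lemma pb_apply {X Y : Type} (A : RAct G X) (B : RAct G Y) (s : X → Y)
    (hs : ∀ p g, s (A.r p g) = B.r (s p) g) (f : Y → M) (p : X) :
    (pb M A B s hs).hom f p = f (s p) := rfl

/-- difference -/
def df (M : Type) [AddCommGroup M] {X : Type} (A : RAct G X) (s : X → X)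
    (hs : ∀ p g, s (A.r p g) = A.r (s p) g) : fr M A ⟶ fr M A := pb M A A s hs - 𝟙 _

lemma df_apply {X : Type} (A : RAct G X) (s : X → X)
    (hs : ∀ p g, s (A.r p g) = A.r (s p) g) (f : X → M) (p : X) :
    (df M A s hs).hom f p = f (s p) - f p := rfl

lemma exists_antidiff (f : ℤ → M) : ∃ F : ℤ → M, ∀ n, F (n + 1) - F n = f n := by
  refine ⟨fun n => ∑ i ∈ Finset.range n.toNat, f i - ∑ i ∈ Finset.range (-n).toNat, f (-i - 1), ?_⟩
  intro n
  rcases n with n | n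
  · have h1 : (Int.ofNat n + 1).toNat = n + 1 := by simp
    have h2 : (-(Int.ofNat n + 1)).toNat = 0 := by simp; try omega
    have h3 : (Int.ofNat n).toNat = n := by simp
    have h4 : (-(Int.ofNat n)).toNat = 0 := by simp
    simp only [h1, h2, h3, h4, Finset.sum_range_succ]
    simp
  · have h1 : (Int.negSucc n + 1).toNat = 0 := by omega
    have h2 : (-(Int.negSucc n + 1)).toNat = n := by omega
    have h3 : (Int.negSucc n).toNat = 0 := by simp
    have h4 : (-(Int.negSucc n)).toNat = n + 1 := by omega
    have h5 : (Int.negSucc n) = -(n : ℤ) - 1 := by omega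
    simp only [h1, h2, h3, h4, Finset.sum_range_succ]
    rw [h5]; simp

lemma rep_exact {k : Type} [CommRing k] (S : ShortComplex (Rep.{0} k G))
    (h : ∀ x : S.X₂, S.g.hom x = 0 → ∃ y : S.X₁, S.f.hom y = x) : S.Exact := by
  refine (ShortComplex.exact_map_iff_of_faithful _ (forget₂ (Rep.{0} k G) (ModuleCat.{0} k))).1 ?_
  rw [ShortComplex.moduleCat_exact_iff]
  exact h

section ses
variable {X Y : Type} (A : RAct G X) (B : RAct G Y) (e : X ≃ Y × ℤ) (s : X → X)
    (hs : ∀ p g, s (A.r p g) = A.r (s p) g)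
    (hp : ∀ p g, (e (A.r p g)).1 = B.r (e p).1 g)
    (he : ∀ p, e (s p) = ((e p).1, (e p).2 + 1))

/-- the short complex -/
def sc (M : Type) [AddCommGroup M] (he : ∀ p, e (s p) = ((e p).1, (e p).2 + 1)) :
    ShortComplex (Rep.{0} ℤ G) :=
  ShortComplex.mk (pb M A B (fun p => (e p).1) hp) (df M A s hs) (by
    ext f p
    change f (e (s p)).1 - f (e p).1 = 0
    rw [he]; simp)

lemma sc_exact : (sc A B e s hs hp M he).ShortExact := by
  have hinj : Function.Injective (sc A B e s hs hp M he).f.hom := by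
    intro f f' h
    funext y
    have := congrFun h (e.symm (y, 0))
    change f (e _).1 = f' (e _).1 at this
    simpa using this
  have hsurj : Function.Surjective (sc A B e s hs hp M he).g.hom := by
    intro (f : X → M)
    choose F hF using fun y : Y => exists_antidiff (fun n => f (e.symm (y, n)))
    refine ⟨fun p => F (e p).1 (e p).2, ?_⟩
    funext p
    change F (e (s p)).1 (e (s p)).2 - F (e p).1 (e p).2 = f p
    rw [he]
    simp [hF]
  refine @ShortComplex.ShortExact.mk _ _ _ _ ?_ ((Rep.mono_iff_injective _).2 hinj) ((Rep.epi_iff_surjective _).2 hsurj)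
  apply rep_exact
  intro (f : X → M) hf
  refine ⟨fun y => f (e.symm (y, 0)), ?_⟩
  have h : ∀ p, f (s p) = f p := fun p => sub_eq_zero.1 (congrFun hf p)
  have h2 : ∀ y (n : ℤ), f (e.symm (y, n + 1)) = f (e.symm (y, n)) := by
    intro y n
    rw [← h (e.symm (y, n))]
    congr 1
    apply e.injective
    simp [he]
  have h3 : ∀ y (n : ℤ), f (e.symm (y, n)) = f (e.symm (y, 0)) := by
    intro y n
    induction n using Int.induction_on with
    | zero => rfl
    | succ n ih => rw [h2, ih]
    | pred n ih => rw [← ih, ← h2]; simp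
  funext p
  change f (e.symm ((e p).1, 0)) = f p
  rw [← h3 _ (e p).2]; simp
end ses


section les
open groupCohomology Limits
variable {X : ShortComplex (Rep.{0} ℤ G)}

lemma isZero_succ (hX : X.ShortExact) (n : ℕ) (h3 : IsZero (groupCohomology X.X₃ n))
    (h2 : IsZero (groupCohomology X.X₂ (n + 1))) : IsZero (groupCohomology X.X₁ (n + 1)) :=
  (mapShortComplex₁_exact hX (rfl : n + 1 = n + 1)).isZero_of_both_zeros
    (h3.eq_of_src _ _) (h2.eq_of_tgt _ _)

lemma mono_δ (hX : X.ShortExact) (n : ℕ) (h : groupCohomology.map (MonoidHom.id G) X.g n = 0) :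
    Mono (δ hX n (n + 1) rfl) :=
  (mapShortComplex₃_exact hX (rfl : n + 1 = n + 1)).mono_g h

lemma isIso_δ (hX : X.ShortExact) (n : ℕ) (h : groupCohomology.map (MonoidHom.id G) X.g n = 0)
    (h2 : IsZero (groupCohomology X.X₂ (n + 1))) :
    IsIso (δ hX n (n + 1) rfl) := by
  have := mono_δ hX n h
  have := epi_δ_of_isZero hX n h2
  exact isIso_of_mono_of_epi _

lemma map_zero_succ (hX : X.ShortExact) (n : ℕ) (F : X ⟶ X) (h2 : IsZero (groupCohomology X.X₂ (n + 1)))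
    (h : groupCohomology.map (MonoidHom.id G) F.τ₃ n = 0) :
    groupCohomology.map (MonoidHom.id G) F.τ₁ (n + 1) = 0 := by
  have := epi_δ_of_isZero hX n h2
  rw [← cancel_epi (δ hX n (n + 1) rfl), δ_naturality hX hX F n (n + 1) rfl, h]
  simp
end les

section T0
open groupCohomology Limits

def regAct (G : Type) [Group G] : RAct G G := ⟨fun p g => p * g, by simp, by simp [mul_assoc]⟩

def regIso (M : Type) [AddCommGroup M] : fr M (regAct G) ≅
    Rep.coind (⊥ : Subgroup G).subtype (Rep.trivial ℤ (⊥ : Subgroup G) M) :=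
  Rep.mkIso (Representation.Equiv.mk (σ := Representation.coind (⊥ : Subgroup G).subtype
      (Rep.trivial ℤ (⊥ : Subgroup G) M).ρ)
    { toFun := fun (f : G → M) => ⟨f, by
          rintro ⟨g, hg⟩ h
          obtain rfl := Subgroup.mem_bot.1 hg
          simp⟩
      invFun := fun f => f.1
      map_add' := fun _ _ => rfl
      map_smul' := fun _ _ => rfl
      left_inv := fun _ => rfl
      right_inv := fun _ => rfl } (fun g => rfl))

noncomputable def cohIso {A B : Rep.{0} ℤ G} (i : A ≅ B) (n : ℕ) : groupCohomology A n ≅ groupCohomology B n :=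
  (groupCohomology.functor ℤ G n).mapIso i

lemma isZero_reg (n : ℕ) : IsZero (groupCohomology (fr M (regAct G)) (n + 1)) :=
  (isZero_groupCohomology_succ_of_subsingleton _ n).of_iso
    (cohIso (regIso M) (n + 1) ≪≫ coindIso _ (n + 1))

noncomputable def H0reg : groupCohomology (fr M (regAct G)) 0 ≅ ModuleCat.of ℤ M :=
  cohIso (regIso M) 0 ≪≫ coindIso _ 0 ≪≫ H0IsoOfIsTrivial _

lemma map0_zero (s : G → G) (hs) :
    groupCohomology.map (A := fr M (regAct G)) (B := fr M (regAct G)) (MonoidHom.id G)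
      (df M (regAct G) s hs) 0 = 0 := by
  rw [← cancel_mono (H0Iso _).hom, map_id_comp_H0Iso_hom]
  have : (Rep.invariantsFunctor ℤ G).map (df M (regAct G) s hs) = 0 := by
    apply ModuleCat.hom_ext
    apply LinearMap.ext
    rintro ⟨(f : G → M), hf⟩
    apply Subtype.ext
    funext p
    change f (s p) - f p = 0
    have := congrFun (hf (p⁻¹ * s p)) p
    change f (p * _) = f p at this
    rw [← this]; simp
  rw [this]
  simp
end T0


section main
open groupCohomology Limits

/-- endomorphism of the short complex -/
def scEnd {X Y : Type} (A : RAct G X) (B : RAct G Y) (e : X ≃ Y × ℤ) (s : X → X)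
    (hs : ∀ p g, s (A.r p g) = A.r (s p) g)
    (hp : ∀ p g, (e (A.r p g)).1 = B.r (e p).1 g)
    (he : ∀ p, e (s p) = ((e p).1, (e p).2 + 1))
    (t : X → X) (ht : ∀ p g, t (A.r p g) = A.r (t p) g)
    (t' : Y → Y) (ht' : ∀ p g, t' (B.r p g) = B.r (t' p) g)
    (hst : ∀ p, s (t p) = t (s p)) (htt : ∀ p, (e (t p)).1 = t' (e p).1) :
    sc A B e s hs hp M he ⟶ sc A B e s hs hp M he where
  τ₁ := df M B t' ht'
  τ₂ := df M A t ht
  τ₃ := df M A t ht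
  comm₁₂ := by
    apply Rep.hom_ext; ext f; funext p
    change f (t' (e p).1) - f (e p).1 = f (e (t p)).1 - f (e p).1
    rw [htt]
  comm₂₃ := by
    apply Rep.hom_ext; ext f; funext p
    change f (t (s p)) - f (s p) - (f (t p) - f p) = f (s (t p)) - f (t p) - (f (s p) - f p)
    rw [hst]; abel

theorem H3 (E : G ≃ (ℤ × ℤ) × ℤ)
    (hE : ∀ g h, E (g * h) = (((E g).1.1 + (E h).1.1, (E g).1.2 + (E h).1.2),
      (E g).2 + (E h).2 + (E g).1.1 * (E h).1.2)) (M : Type) [AddCommGroup M] :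
    Nonempty (groupCohomology (Rep.trivial ℤ G M) 3 ≃ₗ[ℤ] M) := by
  have hE1 : E 1 = ((0, 0), 0) := by
    have := hE 1 1
    simp only [mul_one, Prod.ext_iff] at this
    obtain ⟨⟨h1, h2⟩, h3⟩ := this
    have h1 : (E 1).1.1 = 0 := by omega
    have h2 : (E 1).1.2 = 0 := by omega
    rw [h1] at h3
    ext <;> simp <;> omega
  let A0 := regAct G
  let A1 : RAct G (ℤ × ℤ) := ⟨fun p g => (p.1 + (E g).1.1, p.2 + (E g).1.2),
    by simp [hE1], by simp [hE, add_assoc]⟩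
  let A2 : RAct G ℤ := ⟨fun p g => p + (E g).1.1, by simp [hE1], by simp [hE, add_assoc]⟩
  let A3 : RAct G Unit := ⟨fun p _ => p, by simp, by simp⟩
  -- translations on `A0`
  let x0 : G → G := fun g => E.symm ((1, 0), 0) * g
  let y0 : G → G := fun g => E.symm ((0, 1), 0) * g
  let z0 : G → G := fun g => E.symm ((0, 0), 1) * g
  have hx0 : ∀ p g, x0 (A0.r p g) = A0.r (x0 p) g := fun p g => (mul_assoc _ _ _).symm
  have hy0 : ∀ p g, y0 (A0.r p g) = A0.r (y0 p) g := fun p g => (mul_assoc _ _ _).symm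
  have hz0 : ∀ p g, z0 (A0.r p g) = A0.r (z0 p) g := fun p g => (mul_assoc _ _ _).symm
  let x1 : ℤ × ℤ → ℤ × ℤ := fun p => (p.1 + 1, p.2)
  let y1 : ℤ × ℤ → ℤ × ℤ := fun p => (p.1, p.2 + 1)
  have hx1 : ∀ p g, x1 (A1.r p g) = A1.r (x1 p) g := fun p g => by
    simp [x1, A1, add_right_comm]
  have hy1 : ∀ p g, y1 (A1.r p g) = A1.r (y1 p) g := fun p g => by
    simp [y1, A1, add_right_comm]
  let x2 : ℤ → ℤ := fun p => p + 1
  have hx2 : ∀ p g, x2 (A2.r p g) = A2.r (x2 p) g := fun p g => by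
    simp [x2, A2, add_right_comm]
  -- exact sequences
  have p0 : ∀ p g, (E (A0.r p g)).1 = A1.r (E p).1 g := fun p g => by
    simp [A0, A1, regAct, hE]
  have e0 : ∀ p, E (z0 p) = ((E p).1, (E p).2 + 1) := fun p => by
    simp [z0, hE, add_comm]
  have p1 : ∀ p g, ((Equiv.refl (ℤ × ℤ)) (A1.r p g)).1 = A2.r ((Equiv.refl (ℤ × ℤ)) p).1 g :=
    fun p g => rfl
  have e1 : ∀ p, (Equiv.refl (ℤ × ℤ)) (y1 p) =
    (((Equiv.refl (ℤ × ℤ)) p).1, ((Equiv.refl (ℤ × ℤ)) p).2 + 1) := fun p => rfl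
  let c : ℤ ≃ Unit × ℤ := (Equiv.punitProd ℤ).symm
  have p2 : ∀ p g, (c (A2.r p g)).1 = A3.r (c p).1 g := fun p g => rfl
  have e2 : ∀ p, c (x2 p) = ((c p).1, (c p).2 + 1) := fun p => rfl
  have S0 := sc_exact (M := M) A0 A1 E z0 hz0 p0 e0
  have S1 := sc_exact (M := M) A1 A2 (Equiv.refl _) y1 hy1 p1 e1
  have S2 := sc_exact (M := M) A2 A3 c x2 hx2 p2 e2
  -- vanishing
  have V0 : ∀ n, IsZero (groupCohomology (fr M A0) (n + 1)) := fun n => isZero_reg n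
  have V1 : ∀ n, IsZero (groupCohomology (fr M A1) (n + 2)) := fun n =>
    isZero_succ S0 (n + 1) (V0 n) (V0 (n + 1))
  have V2 : ∀ n, IsZero (groupCohomology (fr M A2) (n + 3)) := fun n =>
    isZero_succ S1 (n + 2) (V1 n) (V1 (n + 1))
  -- zero maps
  have hzy : ∀ p, z0 (y0 p) = y0 (z0 p) := fun p => E.injective (by
    simp [z0, y0, hE, add_comm])
  have hzx : ∀ p, z0 (x0 p) = x0 (z0 p) := fun p => E.injective (by
    simp [z0, x0, hE, add_comm, add_left_comm])
  have Zy1 := map_zero_succ S0 0 (scEnd A0 A1 E z0 hz0 p0 e0 y0 hy0 y1 hy1 hzy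
    (fun p => by simp [y0, y1, hE, add_comm])) (V0 0) (map0_zero y0 hy0)
  have Zx1 := map_zero_succ S0 0 (scEnd A0 A1 E z0 hz0 p0 e0 x0 hx0 x1 hx1 hzx
    (fun p => by simp [x0, x1, hE, add_comm])) (V0 0) (map0_zero x0 hx0)
  have Zx2 := map_zero_succ S1 1 (scEnd A1 A2 (Equiv.refl _) y1 hy1 p1 e1 x1 hx1 x2 hx2
    (fun p => rfl) (fun p => rfl)) (V1 0) Zx1
  have I0 := isIso_δ S0 0 (map0_zero z0 hz0) (V0 0)
  have I1 := isIso_δ S1 1 Zy1 (V1 0)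
  have I2 := isIso_δ S2 2 Zx2 (V2 0)
  let tr : fr M A3 ≅ Rep.trivial ℤ G M :=
    Rep.mkIso (Representation.Equiv.mk (LinearEquiv.funUnique Unit ℤ M) (fun g => rfl))
  exact ⟨((cohIso tr 3).symm ≪≫ (asIso (δ S2 2 3 rfl)).symm ≪≫ (asIso (δ S1 1 2 rfl)).symm ≪≫
    (asIso (δ S0 0 1 rfl)).symm ≪≫ H0reg).toLinearEquiv⟩
end main
end HeisH3

namespace HeisModel

/-- integer upper unitriangular 3 by 3 matrices, in coordinates -/
@[ext] structure Hs where
  a : ℤ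
  b : ℤ
  c : ℤ

instance : Mul Hs := ⟨fun g h => ⟨g.a + h.a, g.b + h.b, g.c + h.c + g.a * h.b⟩⟩
instance : One Hs := ⟨⟨0, 0, 0⟩⟩
instance : Inv Hs := ⟨fun g => ⟨-g.a, -g.b, -g.c + g.a * g.b⟩⟩

@[simp] lemma mul_a (g h : Hs) : (g * h).a = g.a + h.a := rfl
@[simp] lemma mul_b (g h : Hs) : (g * h).b = g.b + h.b := rfl
@[simp] lemma mul_c (g h : Hs) : (g * h).c = g.c + h.c + g.a * h.b := rfl
@[simp] lemma one_a : (1 : Hs).a = 0 := rfl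
@[simp] lemma one_b : (1 : Hs).b = 0 := rfl
@[simp] lemma one_c : (1 : Hs).c = 0 := rfl
@[simp] lemma inv_a (g : Hs) : (g⁻¹).a = -g.a := rfl
@[simp] lemma inv_b (g : Hs) : (g⁻¹).b = -g.b := rfl
@[simp] lemma inv_c (g : Hs) : (g⁻¹).c = -g.c + g.a * g.b := rfl

instance : Group Hs := Group.ofLeftAxioms
  (fun g h k => by ext <;> simp <;> ring)
  (fun g => by ext <;> simp)
  (fun g => by ext <;> simp)

def hx : Hs := ⟨1, 0, 0⟩
def hy : Hs := ⟨0, 1, 0⟩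
def hz : Hs := ⟨0, 0, 1⟩

lemma one_param (f : ℤ → Hs) (h0 : f 0 = 1) (g : Hs) (h : ∀ n, f (n + 1) = f n * g) (n : ℤ) :
    g ^ n = f n := by
  induction n using Int.induction_on with
  | zero => simp [h0]
  | succ n ih => rw [zpow_add_one, ih, h]
  | pred n ih =>
    have := h (-n - 1)
    rw [sub_add_cancel] at this
    rw [zpow_sub_one, ih, this, mul_inv_cancel_right]

lemma hx_zpow (n : ℤ) : hx ^ n = ⟨n, 0, 0⟩ :=
  one_param (fun n => ⟨n, 0, 0⟩) rfl hx (fun n => by ext <;> simp [hx]) n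
lemma hy_zpow (n : ℤ) : hy ^ n = ⟨0, n, 0⟩ :=
  one_param (fun n => ⟨0, n, 0⟩) rfl hy (fun n => by ext <;> simp [hy]) n
lemma hz_zpow (n : ℤ) : hz ^ n = ⟨0, 0, n⟩ :=
  one_param (fun n => ⟨0, 0, n⟩) rfl hz (fun n => by ext <;> simp [hz]) n

abbrev gx : HeisenbergGroup := PresentedGroup.of 0
abbrev gy : HeisenbergGroup := PresentedGroup.of 1
abbrev gz : HeisenbergGroup := PresentedGroup.of 2

/-- universal property -/
lemma rels_hold {K : Type} [Group K] (F : Fin 3 → K)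
    (h1 : F 0 * F 1 * (F 0)⁻¹ * (F 1)⁻¹ * (F 2)⁻¹ = 1)
    (h2 : F 0 * F 2 * (F 0)⁻¹ * (F 2)⁻¹ = 1)
    (h3 : F 1 * F 2 * (F 1)⁻¹ * (F 2)⁻¹ = 1) :
    ∀ r ∈ heisenbergRels, FreeGroup.lift F r = 1 := by
  intro r hr
  simp only [heisenbergRels, Set.mem_insert_iff, Set.mem_singleton_iff] at hr
  rcases hr with rfl | rfl | rfl <;> simpa

lemma rel1 : gx * gy * gx⁻¹ * gy⁻¹ * gz⁻¹ = 1 :=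
  PresentedGroup.one_of_mem (rels := heisenbergRels)
    (x := FreeGroup.of 0 * FreeGroup.of 1 * (FreeGroup.of 0)⁻¹ * (FreeGroup.of 1)⁻¹ *
      (FreeGroup.of 2)⁻¹) (by simp [heisenbergRels])

lemma rel2 : gx * gz * gx⁻¹ * gz⁻¹ = 1 :=
  PresentedGroup.one_of_mem (rels := heisenbergRels)
    (x := FreeGroup.of 0 * FreeGroup.of 2 * (FreeGroup.of 0)⁻¹ * (FreeGroup.of 2)⁻¹)
    (by simp [heisenbergRels])

lemma rel3 : gy * gz * gy⁻¹ * gz⁻¹ = 1 :=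
  PresentedGroup.one_of_mem (rels := heisenbergRels)
    (x := FreeGroup.of 1 * FreeGroup.of 2 * (FreeGroup.of 1)⁻¹ * (FreeGroup.of 2)⁻¹)
    (by simp [heisenbergRels])

lemma comm_xz : gx * gz = gz * gx := by
  have := rel2
  rwa [mul_inv_eq_one, mul_inv_eq_iff_eq_mul] at this

lemma comm_yz : gy * gz = gz * gy := by
  have := rel3
  rwa [mul_inv_eq_one, mul_inv_eq_iff_eq_mul] at this

lemma conj_xy : gx * gy * gx⁻¹ = gz * gy := by
  have := rel1
  rwa [mul_inv_eq_one, mul_inv_eq_iff_eq_mul] at this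

def toHs : HeisenbergGroup →* Hs :=
  PresentedGroup.toGroup (rels := heisenbergRels) (f := ![hx, hy, hz]) (by
    apply rels_hold
    · ext <;> simp [hx, hy, hz]
    · ext <;> simp [hx, hy, hz]
    · ext <;> simp [hx, hy, hz])

lemma toHs_x : toHs gx = hx := by simp [toHs, gx]
lemma toHs_y : toHs gy = hy := by simp [toHs, gy]
lemma toHs_z : toHs gz = hz := by simp [toHs, gz]

lemma swap (m n : ℤ) : gx ^ m * gy ^ n = gy ^ n * gx ^ m * gz ^ (m * n) := by
  have cxz : Commute gx gz := comm_xz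
  have cyz : Commute gy gz := comm_yz
  have h1 : gx * gy ^ n * gx⁻¹ = gz ^ n * gy ^ n := by
    rw [← conj_zpow, conj_xy, cyz.symm.mul_zpow]
  have h2 : (gy ^ n)⁻¹ * gx * gy ^ n = gx * gz ^ n := by
    have h3 : gx * gy ^ n = gz ^ n * gy ^ n * gx := by rw [← h1]; group
    have h4 : gz ^ n * gy ^ n = gy ^ n * gz ^ n := (cyz.symm.zpow_zpow n n).eq
    rw [mul_assoc, h3, h4, mul_assoc, inv_mul_cancel_left, (cxz.zpow_right n).eq]
  have h5 : (gy ^ n)⁻¹ * gx ^ m * gy ^ n = gx ^ m * gz ^ (m * n) := by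
    have := conj_zpow (i := m) (a := (gy ^ n)⁻¹) (b := gx)
    rw [inv_inv] at this
    rw [← this, h2, (cxz.zpow_right n).mul_zpow, ← zpow_mul, mul_comm n m]
  rw [mul_assoc (gy ^ n), ← h5]; group

def ofHs : Hs →* HeisenbergGroup := MonoidHom.mk' (fun g => gy ^ g.b * gx ^ g.a * gz ^ g.c) (by
  intro g h
  have cxz : Commute gx gz := comm_xz
  have cyz : Commute gy gz := comm_yz
  simp only [mul_a, mul_b, mul_c]
  have e1 : gz ^ g.c * (gy ^ h.b * gx ^ h.a * gz ^ h.c)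
      = gy ^ h.b * gx ^ h.a * gz ^ h.c * gz ^ g.c :=
    ((((cyz.symm.zpow_zpow g.c h.b).mul_right (cxz.symm.zpow_zpow g.c h.a)).mul_right
      ((Commute.refl gz).zpow_zpow g.c h.c))).eq
  have e2 : gz ^ (g.a * h.b) * gx ^ h.a = gx ^ h.a * gz ^ (g.a * h.b) :=
    (cxz.symm.zpow_zpow _ _).eq
  symm
  calc gy ^ g.b * gx ^ g.a * gz ^ g.c * (gy ^ h.b * gx ^ h.a * gz ^ h.c)
      = gy ^ g.b * gx ^ g.a * (gz ^ g.c * (gy ^ h.b * gx ^ h.a * gz ^ h.c)) := by group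
    _ = gy ^ g.b * (gx ^ g.a * gy ^ h.b) * gx ^ h.a * gz ^ h.c * gz ^ g.c := by
        rw [e1]; group
    _ = gy ^ g.b * gy ^ h.b * gx ^ g.a * (gz ^ (g.a * h.b) * gx ^ h.a) * gz ^ h.c * gz ^ g.c := by
        rw [swap]; group
    _ = _ := by
        rw [e2]; group)

lemma ofHs_toHs (g : HeisenbergGroup) : ofHs (toHs g) = g := by
  have : ofHs.comp toHs = MonoidHom.id _ := by
    apply PresentedGroup.ext
    intro i
    fin_cases i
    · change ofHs (toHs gx) = gx
      rw [toHs_x]; simp [ofHs, hx]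
    · change ofHs (toHs gy) = gy
      rw [toHs_y]; simp [ofHs, hy]
    · change ofHs (toHs gz) = gz
      rw [toHs_z]; simp [ofHs, hz]
  exact DFunLike.congr_fun this g

lemma toHs_ofHs (g : Hs) : toHs (ofHs g) = g := by
  simp only [ofHs, MonoidHom.mk'_apply, map_mul, map_zpow, toHs_x, toHs_y, toHs_z, hx_zpow, hy_zpow,
    hz_zpow]
  ext <;> simp

def coords : HeisenbergGroup ≃ (ℤ × ℤ) × ℤ where
  toFun g := (((toHs g).a, (toHs g).b), (toHs g).c)
  invFun p := ofHs ⟨p.1.1, p.1.2, p.2⟩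
  left_inv g := ofHs_toHs g
  right_inv p := by simp [toHs_ofHs]

lemma coords_mul (g h : HeisenbergGroup) : coords (g * h) =
    (((coords g).1.1 + (coords h).1.1, (coords g).1.2 + (coords h).1.2),
      (coords g).2 + (coords h).2 + (coords g).1.1 * (coords h).1.2) := by
  simp [coords]

/-! ### H² -/
open groupCohomology

section ext
variable {G : Type} [Group G] {M : Type} [AddCommGroup M]

/-- extension group of a 2-cocycle -/
@[ext] structure CExt (f : cocycles₂ (Rep.trivial ℤ G M)) where
  m : M
  g : G

variable (f : cocycles₂ (Rep.trivial ℤ G M))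

/-- the cocycle as a plain function -/
def cf (g h : G) : M := f (g, h)

lemma cf_assoc (g h j : G) : cf f (g * h) j + cf f g h = cf f h j + cf f g (h * j) :=
  (mem_cocycles₂_iff (A := Rep.trivial ℤ G M) (f : G × G → M)).1 f.2 g h j

lemma cf_one (g : G) : cf f 1 g = cf f 1 1 := cocycles₂_map_one_fst f g

instance : Mul (CExt f) := ⟨fun p q => ⟨p.m + q.m + cf f p.g q.g, p.g * q.g⟩⟩
instance : One (CExt f) := ⟨⟨-cf f 1 1, 1⟩⟩
instance : Inv (CExt f) := ⟨fun p => ⟨-p.m - cf f p.g⁻¹ p.g - cf f 1 1, p.g⁻¹⟩⟩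

lemma cmul_m (p q : CExt f) : (p * q).m = p.m + q.m + cf f p.g q.g := rfl
lemma cmul_g (p q : CExt f) : (p * q).g = p.g * q.g := rfl
lemma cone_m : (1 : CExt f).m = -cf f 1 1 := rfl
lemma cone_g : (1 : CExt f).g = 1 := rfl
lemma cinv_m (p : CExt f) : (p⁻¹).m = -p.m - cf f p.g⁻¹ p.g - cf f 1 1 := rfl
lemma cinv_g (p : CExt f) : (p⁻¹).g = p.g⁻¹ := rfl

instance : Group (CExt f) := Group.ofLeftAxioms
  (fun p q r => by
    ext
    · simp only [cmul_m, cmul_g]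
      have := cf_assoc f p.g q.g r.g
      calc _ = p.m + q.m + r.m + (cf f (p.g * q.g) r.g + cf f p.g q.g) := by abel
        _ = _ := by rw [this]; abel
    · simp [cmul_g, mul_assoc])
  (fun p => by
    ext
    · simp [cmul_m, cone_m, cone_g, cf_one f p.g]
    · simp [cmul_g, cone_g])
  (fun p => by
    ext
    · simp only [cmul_m, cinv_m, cinv_g, cone_m]; abel
    · simp [cmul_g, cone_g, cinv_g])

def cproj : CExt f →* G := ⟨⟨fun p => p.g, rfl⟩, fun _ _ => rfl⟩

end ext

variable {M : Type} [AddCommGroup M]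

lemma gz_eq : gz = gx * gy * gx⁻¹ * gy⁻¹ := by
  have := rel1
  rw [mul_inv_eq_one] at this
  exact this.symm

lemma coboundary_of_zero (f : cocycles₂ (Rep.trivial ℤ HeisenbergGroup M))
    (h1 : cf f gx gz = cf f gz gx) (h2 : cf f gy gz = cf f gz gy) :
    ∃ u : HeisenbergGroup → M, ∀ g h, u h - u (g * h) + u g = cf f g h := by
  let X : CExt f := ⟨0, gx⟩
  let Y : CExt f := ⟨0, gy⟩
  let Z : CExt f := X * Y * X⁻¹ * Y⁻¹
  have hZ : Z.g = gz := by
    rw [gz_eq]; rfl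
  have hXZ : X * Z = Z * X := by
    ext
    · simp only [cmul_m, hZ]
      change 0 + Z.m + cf f gx gz = Z.m + 0 + cf f gz gx
      rw [h1]; abel
    · change X.g * Z.g = Z.g * X.g
      rw [hZ]; exact comm_xz
  have hYZ : Y * Z = Z * Y := by
    ext
    · simp only [cmul_m, hZ]
      change 0 + Z.m + cf f gy gz = Z.m + 0 + cf f gz gy
      rw [h2]; abel
    · change Y.g * Z.g = Z.g * Y.g
      rw [hZ]; exact comm_yz
  let s : HeisenbergGroup →* CExt f :=
    PresentedGroup.toGroup (rels := heisenbergRels) (f := ![X, Y, Z]) (by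
      apply rels_hold
      · exact mul_inv_cancel Z
      · change X * Z * X⁻¹ * Z⁻¹ = 1
        rw [hXZ]; group
      · change Y * Z * Y⁻¹ * Z⁻¹ = 1
        rw [hYZ]; group)
  have hs : (cproj f).comp s = MonoidHom.id _ := by
    apply PresentedGroup.ext
    intro i
    have : s (PresentedGroup.of i) = ![X, Y, Z] i := PresentedGroup.toGroup.of _
    simp only [MonoidHom.comp_apply, this]
    fin_cases i
    · rfl
    · rfl
    · exact hZ
  have hs' : ∀ g, (s g).g = g := fun g => DFunLike.congr_fun hs g
  refine ⟨fun g => -(s g).m, fun g h => ?_⟩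
  simp only [map_mul, cmul_m, hs']
  abel

def tri (n : ℤ) : ℤ := n * (n - 1) / 2

lemma two_tri (n : ℤ) : 2 * tri n = n * (n - 1) := by
  unfold tri
  apply Int.mul_ediv_cancel'
  have := Int.even_mul_pred_self n
  exact this.two_dvd

lemma tri_add (m n : ℤ) : tri (m + n) = tri m + tri n + m * n := by
  have h1 := two_tri (m + n)
  have h2 := two_tri m
  have h3 := two_tri n
  have : 2 * tri (m + n) = 2 * (tri m + tri n + m * n) := by
    rw [h1, mul_add, mul_add, h2, h3]; ring
  omega

def P (g h : Hs) : ℤ := g.a * h.c + tri g.a * h.b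
def Q (g h : Hs) : ℤ := g.c * h.b + g.a * tri h.b

lemma P_assoc (g h j : Hs) : P (g * h) j + P g h = P h j + P g (h * j) := by
  simp only [P, mul_a, mul_b, mul_c, tri_add]; ring
lemma Q_assoc (g h j : Hs) : Q (g * h) j + Q g h = Q h j + Q g (h * j) := by
  simp only [Q, mul_a, mul_b, mul_c, tri_add]; ring

def theCocycle (m : M × M) : cocycles₂ (Rep.trivial ℤ HeisenbergGroup M) :=
  ⟨fun p => P (toHs p.1) (toHs p.2) • m.1 - Q (toHs p.1) (toHs p.2) • m.2, by
    rw [mem_cocycles₂_iff]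
    intro g h j
    change P (toHs (g * h)) (toHs j) • m.1 - Q (toHs (g * h)) (toHs j) • m.2 +
      (P (toHs g) (toHs h) • m.1 - Q (toHs g) (toHs h) • m.2) =
      (P (toHs h) (toHs j) • m.1 - Q (toHs h) (toHs j) • m.2) +
      (P (toHs g) (toHs (h * j)) • m.1 - Q (toHs g) (toHs (h * j)) • m.2)
    rw [sub_add_sub_comm, sub_add_sub_comm, ← add_smul, ← add_smul, ← add_smul, ← add_smul,
      map_mul, map_mul, P_assoc, Q_assoc]⟩

def Phi : cocycles₂ (Rep.trivial ℤ HeisenbergGroup M) →ₗ[ℤ] M × M where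
  toFun f := (cf f gx gz - cf f gz gx, cf f gy gz - cf f gz gy)
  map_add' f g := by
    change ((cf f gx gz + cf g gx gz) - (cf f gz gx + cf g gz gx),
      (cf f gy gz + cf g gy gz) - (cf f gz gy + cf g gz gy)) = _
    ext <;> simp <;> abel
  map_smul' n f := by
    change (n • cf f gx gz - n • cf f gz gx, n • cf f gy gz - n • cf f gz gy) = _
    ext <;> simp [smul_sub]

lemma Phi_surj : Function.Surjective (Phi (M := M)) := by
  intro m
  refine ⟨theCocycle m, ?_⟩
  change (P (toHs gx) (toHs gz) • m.1 - Q (toHs gx) (toHs gz) • m.2 -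
      (P (toHs gz) (toHs gx) • m.1 - Q (toHs gz) (toHs gx) • m.2),
      P (toHs gy) (toHs gz) • m.1 - Q (toHs gy) (toHs gz) • m.2 -
      (P (toHs gz) (toHs gy) • m.1 - Q (toHs gz) (toHs gy) • m.2)) = m
  rw [toHs_x, toHs_y, toHs_z]
  simp [P, Q, hx, hy, hz, tri]

lemma ker_eq : LinearMap.ker (H2π (Rep.trivial ℤ HeisenbergGroup M)).hom
    = LinearMap.ker (Phi (M := M)) := by
  ext f
  rw [LinearMap.mem_ker, LinearMap.mem_ker]
  refine (H2π_eq_zero_iff f).trans ?_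
  constructor
  · rintro ⟨u, hu⟩
    have hu' : ∀ g h, cf f g h = u h - u (g * h) + u g := fun g h => (congrFun hu (g, h)).symm
    change (cf f gx gz - cf f gz gx, cf f gy gz - cf f gz gy) = 0
    simp only [hu', comm_xz, comm_yz]
    ext <;> simp <;> abel
  · intro h
    have h1 : cf f gx gz - cf f gz gx = 0 := congrArg Prod.fst h
    have h2 : cf f gy gz - cf f gz gy = 0 := congrArg Prod.snd h
    obtain ⟨u, hu⟩ := coboundary_of_zero f (sub_eq_zero.1 h1) (sub_eq_zero.1 h2)
    exact ⟨u, funext fun p => hu p.1 p.2⟩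

theorem H2 (M : Type) [AddCommGroup M] :
    Nonempty ((groupCohomology (Rep.trivial ℤ HeisenbergGroup M) 2) ≃ₗ[ℤ] M × M) := by
  have hs : Function.Surjective (H2π (Rep.trivial ℤ HeisenbergGroup M)).hom :=
    (ModuleCat.epi_iff_surjective _).1 inferInstance
  exact ⟨((LinearMap.quotKerEquivOfSurjective _ hs).symm.trans
    (Submodule.quotEquivOfEq _ _ ker_eq)).trans
    (LinearMap.quotKerEquivOfSurjective _ Phi_surj)⟩

end HeisModel

/-- For any abelian group `M` regarded as a trivial module over the discrete Heisenberg
group `H`, `H²(H, M) ≅ M²` and `H³(H, M) ≅ M`. -/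
theorem cohomology_of_heisenberg_trivial_coefficients (M : Type) [AddCommGroup M] :
    Nonempty ((groupCohomology (Rep.trivial ℤ HeisenbergGroup M) 2) ≃ₗ[ℤ] M × M) ∧
    Nonempty ((groupCohomology (Rep.trivial ℤ HeisenbergGroup M) 3) ≃ₗ[ℤ] M) :=
  ⟨HeisModel.H2 M, HeisH3.H3 HeisModel.coords HeisModel.coords_mul M⟩
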